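/- arXiv:1412.3372 — 3 statements merged into one kernel-verified Lean document; each statement's English description precedes it below -/
import Mathlib

section
/- Let x_l, x_r : [0,1] → ℝ satisfy: (i) x_l is a bounded monotone increasing function; (ii) x_r is a bounded monotone decreasing function; (iii) x_l(1) ≤ x_r(1); (iv) x_l and x_r are left-continuous at every point of (0,1]; (v) x_l and x_r are right-continuous at 0. Define u : ℝ → ℝ by u(t) = sup({0} ∪ {α ∈ (0,1] : x_l(α) ≤ t ∧ t ≤ x_r(α)}). Then for every α ∈ (0,1] the level set {t ∈ ℝ : u(t) ≥ α} equals the closed interval [x_l(α), x_r(α)], and the closure of {t ∈ ℝ : u(t) > 0} equals [x_l(0), x_r(0)]. In particular the family of intervals [x_l(α), x_r(α)] is the parametric (level-set) form of a fuzzy number. -/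
open Set Filter Topology

/-- Goetschel–Voxman representation lemma (Lemma 2.1): the level sets of the
fuzzy number constructed from admissible endpoint functions `xl`, `xr` are
exactly the intervals `[xl α, xr α]`. -/
theorem goetschel_voxman_representation
    (xl xr : ℝ → ℝ)
    (hmono : MonotoneOn xl (Set.Icc (0:ℝ) 1))
    (hbddl : BddAbove (xl '' Set.Icc (0:ℝ) 1) ∧ BddBelow (xl '' Set.Icc (0:ℝ) 1))
    (hanti : AntitoneOn xr (Set.Icc (0:ℝ) 1))
    (hbddr : BddAbove (xr '' Set.Icc (0:ℝ) 1) ∧ BddBelow (xr '' Set.Icc (0:ℝ) 1))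
    (hle : xl 1 ≤ xr 1)
    (hleftl : ∀ k ∈ Set.Ioc (0:ℝ) 1, Tendsto xl (𝓝[<] k) (𝓝 (xl k)))
    (hleftr : ∀ k ∈ Set.Ioc (0:ℝ) 1, Tendsto xr (𝓝[<] k) (𝓝 (xr k)))
    (hrightl : Tendsto xl (𝓝[>] (0:ℝ)) (𝓝 (xl 0)))
    (hrightr : Tendsto xr (𝓝[>] (0:ℝ)) (𝓝 (xr 0)))
    (u : ℝ → ℝ)
    (hu : ∀ t : ℝ, u t =
      sSup ({0} ∪ {α : ℝ | α ∈ Set.Ioc (0:ℝ) 1 ∧ xl α ≤ t ∧ t ≤ xr α})) :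
    (∀ α ∈ Set.Ioc (0:ℝ) 1, {t : ℝ | α ≤ u t} = Set.Icc (xl α) (xr α)) ∧
      closure {t : ℝ | 0 < u t} = Set.Icc (xl 0) (xr 0) := by
  have hbdd : ∀ t : ℝ, BddAbove
      ({0} ∪ {α : ℝ | α ∈ Set.Ioc (0:ℝ) 1 ∧ xl α ≤ t ∧ t ≤ xr α}) := by
    intro t
    refine ⟨1, ?_⟩
    rintro x (hx | hx)
    · rw [Set.mem_singleton_iff.1 hx]; exact zero_le_one
    · exact hx.1.2
  have hge : ∀ t, ∀ α ∈ Set.Ioc (0:ℝ) 1, xl α ≤ t → t ≤ xr α → α ≤ u t := by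
    intro t α hα h1 h2
    rw [hu t]
    exact le_csSup (hbdd t) (Or.inr ⟨hα, h1, h2⟩)
  have hlt : ∀ t β, 0 ≤ β → β < u t → ∃ γ ∈ Set.Ioc (0:ℝ) 1, β < γ ∧ xl γ ≤ t ∧ t ≤ xr γ := by
    intro t β hβ h
    rw [hu t] at h
    obtain ⟨γ, hγ, hlt⟩ := exists_lt_of_lt_csSup (Set.Nonempty.inl (Set.singleton_nonempty (0:ℝ))) h
    rcases hγ with hγ | hγ
    · rw [Set.mem_singleton_iff.1 hγ] at hlt
      exact absurd hlt (not_lt.2 hβ)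
    · exact ⟨γ, hγ.1, hlt, hγ.2⟩
  refine ⟨?_, ?_⟩
  · intro α hα
    ext t
    refine ⟨fun h => ?_, fun h => hge t α hα h.1 h.2⟩
    have h : α ≤ u t := h
    have key : ∀ β ∈ Set.Ioo 0 α, xl β ≤ t ∧ t ≤ xr β := by
      intro β hβ
      obtain ⟨γ, hγ, hβγ, h1, h2⟩ := hlt t β hβ.1.le (hβ.2.trans_le h)
      have m1 : β ∈ Set.Icc (0:ℝ) 1 := ⟨hβ.1.le, hβ.2.le.trans hα.2⟩
      have m2 : γ ∈ Set.Icc (0:ℝ) 1 := ⟨hγ.1.le, hγ.2⟩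
      exact ⟨(hmono m1 m2 hβγ.le).trans h1, h2.trans (hanti m1 m2 hβγ.le)⟩
    have ev : ∀ᶠ β in 𝓝[<] α, β ∈ Set.Ioo 0 α := Ioo_mem_nhdsLT hα.1
    exact ⟨le_of_tendsto (hleftl α hα) (ev.mono fun β hβ => (key β hβ).1),
      ge_of_tendsto (hleftr α hα) (ev.mono fun β hβ => (key β hβ).2)⟩
  · apply Set.Subset.antisymm
    · refine closure_minimal ?_ isClosed_Icc
      intro t ht
      obtain ⟨γ, hγ, h0, h1, h2⟩ := hlt t 0 le_rfl ht
      have m1 : (0:ℝ) ∈ Set.Icc (0:ℝ) 1 := ⟨le_rfl, zero_le_one⟩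
      have m2 : γ ∈ Set.Icc (0:ℝ) 1 := ⟨hγ.1.le, hγ.2⟩
      exact ⟨(hmono m1 m2 h0.le).trans h1, h2.trans (hanti m1 m2 h0.le)⟩
    · intro t ht
      have lim : Tendsto (fun α => max (xl α) (min t (xr α))) (𝓝[>] (0:ℝ)) (𝓝 t) := by
        have := hrightl.max ((tendsto_const_nhds (x := t)).min hrightr)
        rwa [min_eq_left ht.2, max_eq_right ht.1] at this
      have ev : ∀ᶠ β in 𝓝[>] (0:ℝ), β ∈ Set.Ioo (0:ℝ) 1 := Ioo_mem_nhdsGT zero_lt_one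
      refine mem_closure_of_tendsto lim (ev.mono fun β hβ => ?_)
      have m1 : β ∈ Set.Icc (0:ℝ) 1 := ⟨hβ.1.le, hβ.2.le⟩
      have m2 : (1:ℝ) ∈ Set.Icc (0:ℝ) 1 := ⟨zero_le_one, le_rfl⟩
      have hlr : xl β ≤ xr β :=
        (hmono m1 m2 hβ.2.le).trans (hle.trans (hanti m1 m2 hβ.2.le))
      exact hβ.1.trans_le (hge _ β ⟨hβ.1, hβ.2.le⟩ (le_max_left _ _)
        (max_le hlr (min_le_right _ _)))
end

section
/- Let q be a real number with 0.58 < q ≤ 0.88 and let t be a real number with 0 < t ≤ 1/10. Then t^(-q) - 1 - t^(q-1) > 0. -/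
theorem aux_lower (t a p : ℝ) (n m : ℕ) (hn : n ≠ 0) (ht0 : 0 < t) (ht1 : t ≤ 1 / 10)
    (hp : p * n = m) (h : a ^ n ≤ 10 ^ m) : a ≤ t ^ (-p) := by
  refine le_of_pow_le_pow_left₀ hn (by positivity) (h.trans ?_)
  rw [← Real.rpow_natCast (t ^ (-p)), ← Real.rpow_mul ht0.le, neg_mul, hp,
    Real.rpow_neg ht0.le, Real.rpow_natCast, ← inv_pow]
  gcongr
  rw [le_inv_comm₀ (by norm_num) ht0]
  linarith

/-- Corrected sign claim of Example 2: on `(0, 1/10]` the coefficient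
`t^(-q) - 1 - t^(q-1)` is positive for all `0.58 < q ≤ 0.88`. -/
theorem coeff_pos_example2 (q t : ℝ) (hq0 : 0.58 < q) (hq1 : q ≤ 0.88)
    (ht0 : 0 < t) (ht1 : t ≤ 1 / 10) :
    t ^ (-q) - 1 - t ^ (q - 1) > 0 := by
  have h1 : (2.6 : ℝ) ≤ t ^ (-0.42 : ℝ) :=
    aux_lower t 2.6 0.42 50 21 (by norm_num) ht0 ht1 (by norm_num) (by norm_num)
  have h2 : (1.4 : ℝ) ≤ t ^ (-0.16 : ℝ) :=
    aux_lower t 1.4 0.16 25 4 (by norm_num) ht0 ht1 (by norm_num) (by norm_num)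
  have h3 : t ^ (-0.58 : ℝ) = t ^ (-0.42 : ℝ) * t ^ (-0.16 : ℝ) := by
    rw [← Real.rpow_add ht0]; norm_num
  have h4 : t ^ (-0.58 : ℝ) ≤ t ^ (-q) :=
    Real.rpow_le_rpow_of_exponent_ge ht0 (by linarith) (by linarith)
  have h5 : t ^ (q - 1) ≤ t ^ (-0.42 : ℝ) :=
    Real.rpow_le_rpow_of_exponent_ge ht0 (by linarith) (by norm_num at *; linarith)
  nlinarith
end

section
/- Let q ∈ (0,1) and let t be a real number with 0 < t ≤ (Real.Gamma (1 - q))^(-1/(1+q)). Then (t^(-q)/Real.Gamma (1 - q) - t) · t^q + t^(1+q)/(1+q) ≤ Real.Gamma (1 + q). -/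
/-- Upper-solution inequality of Example 1: `t^q` is an upper solution on
`(0, b]` with `b = Γ(1-q)^(-1/(1+q))`. -/
theorem upper_solution_example1 (q t : ℝ) (hq0 : 0 < q) (hq1 : q < 1)
    (ht0 : 0 < t) (htb : t ≤ (Real.Gamma (1 - q)) ^ (-1 / (1 + q))) :
    (t ^ (-q) / Real.Gamma (1 - q) - t) * t ^ q + t ^ (1 + q) / (1 + q)
      ≤ Real.Gamma (1 + q) := by
  have hG : 0 < Real.Gamma (1 - q) := Real.Gamma_pos_of_pos (by linarith)
  have hprod : 1 ≤ Real.Gamma (1 + q) * Real.Gamma (1 - q) := by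
    rw [add_comm, Real.Gamma_add_one hq0.ne', mul_assoc, Real.Gamma_mul_Gamma_one_sub,
      ← mul_div_assoc]
    have hx : 0 < Real.pi * q := mul_pos Real.pi_pos hq0
    have hs : 0 < Real.sin (Real.pi * q) :=
      Real.sin_pos_of_pos_of_lt_pi hx (by nlinarith [Real.pi_pos])
    rw [le_div_iff₀ hs]
    linarith [Real.sin_le hx.le]
  have h1 : 1 / Real.Gamma (1 - q) ≤ Real.Gamma (1 + q) := by
    rwa [div_le_iff₀ hG]
  have h2 : t ^ (-q) * t ^ q = 1 := by
    rw [← Real.rpow_add ht0]; simp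
  have h3 : t * t ^ q = t ^ (1 + q) := by
    rw [Real.rpow_add ht0, Real.rpow_one]
  have h4 : t ^ (1 + q) / (1 + q) ≤ t ^ (1 + q) :=
    div_le_self (Real.rpow_pos_of_pos ht0 _).le (by linarith)
  have h5 : (t ^ (-q) / Real.Gamma (1 - q) - t) * t ^ q
      = 1 / Real.Gamma (1 - q) - t ^ (1 + q) := by
    rw [← h3, ← h2]; ring
  rw [h5]
  linarith
end
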